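/- arXiv:2210.03021 — 6 statements merged into one kernel-verified Lean document; each statement's English description precedes it below -/
import Mathlib

section
/- Let α be a finite type, f : α → ℝ with 0 ≤ f a ≤ 1 for all a, and let F be a finite subset of α (the set of ground probabilistic facts used in a proof). Then the sum of the world probabilities P(L) = (∏_{a∈L} f a) · (∏_{a∉L} (1 − f a)) over all L ⊆ α with F ⊆ L equals ∏_{a∈F} f a. Hence the probability of a proof, defined as the marginal over all worlds where the proof holds, equals the product of the probabilities of the (distinct) ground probabilistic facts used in it. -/
open Finset

theorem proof_probability {α : Type*} [Fintype α] [DecidableEq α] (f : α → ℝ)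
    (hf : ∀ a, 0 ≤ f a ∧ f a ≤ 1) (F : Finset α) :
    ∑ L ∈ (Finset.univ : Finset α).powerset.filter (fun L => F ⊆ L),
      ((∏ a ∈ L, f a) * ∏ a ∈ Finset.univ \ L, (1 - f a))
      = ∏ a ∈ F, f a := by
  have h := Finset.prod_add f (fun a => if a ∈ F then 0 else 1 - f a) Finset.univ
  have h1 : ∏ a, (f a + (if a ∈ F then 0 else 1 - f a)) = ∏ a ∈ F, f a := by
    rw [← Finset.prod_subset (Finset.subset_univ F)]
    · apply Finset.prod_congr rfl
      intro a ha
      simp [ha]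
    · intro a _ ha
      simp [ha]
  rw [← h1, h, Finset.sum_filter]
  apply Finset.sum_congr rfl
  intro L _
  split_ifs with hL
  · congr 1
    apply Finset.prod_congr rfl
    intro a ha
    have haF : a ∉ F := fun h => (Finset.mem_sdiff.mp ha).2 (hL h)
    simp [haF]
  · obtain ⟨a, haF, haL⟩ := Finset.not_subset.mp hL
    rw [Finset.prod_eq_zero (i := a) (s := Finset.univ \ L) (by simp [haL]) (by simp [haF]),
      mul_zero]
end

section
/- Let α be a finite type, f : α → ℝ with 0 ≤ f a ≤ 1 for all a, and let F : Fin n → Finset α (n ≥ 1) be the fact-sets of the proofs of a query. Then the success probability ∑_{L ⊆ α, ∃ i, F i ⊆ L} (∏_{a∈L} f a) · (∏_{a∉L} (1 − f a)) equals the inclusion–exclusion sum ∑_{∅ ≠ S ⊆ Fin n} (−1)^{|S|+1} · ∏_{a ∈ ⋃_{i∈S} F i} f a. -/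
open Finset

theorem prod_eq_sum_worlds_aux {α : Type*} [Fintype α] [DecidableEq α]
    (f : α → ℝ) (G : Finset α) :
    ∏ a ∈ G, f a = ∑ L ∈ (Finset.univ : Finset α).powerset,
      if G ⊆ L then ((∏ a ∈ L, f a) * ∏ a ∈ Finset.univ \ L, (1 - f a)) else 0 := by
  have h := Finset.prod_add f (fun a => if a ∈ G then 0 else 1 - f a) Finset.univ
  have h1 : ∏ a, (f a + (if a ∈ G then 0 else 1 - f a)) = ∏ a ∈ G, f a := by
    rw [← Finset.prod_subset (Finset.subset_univ G)]
    · exact Finset.prod_congr rfl (fun a ha => by simp [ha])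
    · intro a _ ha
      simp [ha]
  rw [← h1, h]
  refine Finset.sum_congr rfl (fun L _ => ?_)
  split_ifs with hL
  · congr 1
    refine Finset.prod_congr rfl (fun a ha => ?_)
    have : a ∉ G := fun h => (Finset.mem_sdiff.1 ha).2 (hL h)
    simp [this]
  · obtain ⟨a, ha, haL⟩ := Finset.not_subset.1 hL
    rw [Finset.prod_eq_zero (i := a) (s := Finset.univ \ L) (by simp [haL]) (by simp [ha]),
      mul_zero]

theorem success_probability_inclusion_exclusion {α : Type*} [Fintype α] [DecidableEq α]
    (f : α → ℝ) (hf : ∀ a, 0 ≤ f a ∧ f a ≤ 1)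
    (n : ℕ) (hn : 1 ≤ n) (F : Fin n → Finset α) :
    ∑ L ∈ (Finset.univ : Finset α).powerset.filter (fun L => ∃ i, F i ⊆ L),
      ((∏ a ∈ L, f a) * ∏ a ∈ Finset.univ \ L, (1 - f a))
      = ∑ S ∈ (Finset.univ : Finset (Fin n)).powerset.filter (fun S => S ≠ ∅),
          (-1 : ℝ) ^ (S.card + 1) * ∏ a ∈ S.biUnion F, f a := by
  rw [Finset.sum_congr (s₁ := (Finset.univ : Finset (Fin n)).powerset.filter (fun S => S ≠ ∅)) rfl
    (fun S _ => by rw [prod_eq_sum_worlds_aux f (S.biUnion F), Finset.mul_sum])]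
  rw [Finset.sum_comm, Finset.sum_filter]
  refine Finset.sum_congr rfl (fun L _ => ?_)
  have h := Finset.indicator_biUnion_eq_sum_powerset (Finset.univ : Finset (Fin n))
    (fun i => {L : Finset α | F i ⊆ L})
    (fun L => ((∏ a ∈ L, f a) * ∏ a ∈ Finset.univ \ L, (1 - f a))) L
  classical
  simp only [Set.indicator_apply, Set.mem_iUnion, Set.mem_iInter, Set.mem_setOf_eq,
    Finset.mem_univ, exists_prop, true_and] at h
  simp only [Finset.biUnion_subset]
  convert h using 1
  refine Finset.sum_congr (by ext; simp [Finset.nonempty_iff_ne_empty]) (fun S _ => ?_)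
  simp [zsmul_eq_mul]
end

section
/- Let α be a finite type, f : α → ℝ with 0 ≤ f a ≤ 1 for all a, and let F₁, F₂ be finite subsets of α. Then ∑_{L ⊆ α, F₁ ⊆ L ∨ F₂ ⊆ L} (∏_{a∈L} f a) · (∏_{a∉L} (1 − f a)) = (∏_{a∈F₁} f a) + (∏_{a∈F₂} f a) − (∏_{a∈F₁∪F₂} f a). -/
open Finset

/-- The probability that all facts of `F` are true. -/
theorem sum_worlds_superset {α : Type*} [Fintype α] [DecidableEq α]
    (f : α → ℝ) (F : Finset α) :
    ∑ L ∈ (Finset.univ : Finset α).powerset,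
      (if F ⊆ L then ((∏ a ∈ L, f a) * ∏ a ∈ Finset.univ \ L, (1 - f a)) else 0)
      = ∏ a ∈ F, f a := by
  have h := Finset.prod_add f (fun a => if a ∈ F then 0 else 1 - f a) Finset.univ
  have h1 : ∏ a, (f a + if a ∈ F then 0 else 1 - f a) = ∏ a ∈ F, f a := by
    rw [← Finset.prod_subset (Finset.subset_univ F)]
    · exact Finset.prod_congr rfl fun a ha => by simp [ha]
    · intro a _ ha
      simp [ha]
  rw [← h1, h]
  refine Finset.sum_congr rfl fun L _ => ?_
  split_ifs with hF
  · congr 1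
    refine Finset.prod_congr rfl fun a ha => ?_
    have : a ∉ F := fun h => (Finset.mem_sdiff.1 ha).2 (hF h)
    simp [this]
  · obtain ⟨a, ha, haL⟩ := Finset.not_subset.1 hF
    symm
    apply mul_eq_zero_of_right
    exact Finset.prod_eq_zero (i := a) (by simp [haL]) (by simp [ha])

theorem success_probability_two_proofs {α : Type*} [Fintype α] [DecidableEq α]
    (f : α → ℝ) (hf : ∀ a, 0 ≤ f a ∧ f a ≤ 1) (F₁ F₂ : Finset α) :
    ∑ L ∈ (Finset.univ : Finset α).powerset.filter (fun L => F₁ ⊆ L ∨ F₂ ⊆ L),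
      ((∏ a ∈ L, f a) * ∏ a ∈ Finset.univ \ L, (1 - f a))
      = (∏ a ∈ F₁, f a) + (∏ a ∈ F₂, f a) - ∏ a ∈ F₁ ∪ F₂, f a := by
  rw [← sum_worlds_superset f F₁, ← sum_worlds_superset f F₂,
    ← sum_worlds_superset f (F₁ ∪ F₂), ← Finset.sum_add_distrib, ← Finset.sum_sub_distrib,
    Finset.sum_filter]
  refine Finset.sum_congr rfl fun L _ => ?_
  by_cases h1 : F₁ ⊆ L <;> by_cases h2 : F₂ ⊆ L <;> simp [Finset.union_subset_iff, h1, h2]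
end

section
/- Let α be a finite type, f : α → ℝ with 0 < f a < 1 for all a, and let F₁, F₂ be finite subsets of α whose union is nonempty. Then the success probability ∑_{L ⊆ α, F₁ ⊆ L ∨ F₂ ⊆ L} (∏_{a∈L} f a) · (∏_{a∉L} (1 − f a)) is strictly smaller than the sum of the proof probabilities (∏_{a∈F₁} f a) + (∏_{a∈F₂} f a). Hence, when proofs may overlap, the probability of a query cannot in general be computed as the sum of the probabilities of its successful derivations. -/
open Finset

lemma sum_worlds_eq {α : Type*} [Fintype α] [DecidableEq α] (f : α → ℝ) (F : Finset α) :
    ∑ L ∈ (Finset.univ : Finset α).powerset.filter (fun L => F ⊆ L),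
      ((∏ a ∈ L, f a) * ∏ a ∈ Finset.univ \ L, (1 - f a)) = ∏ a ∈ F, f a := by
  have h := Finset.prod_add f (fun a => if a ∈ F then 0 else 1 - f a) Finset.univ
  have h1 : ∏ a, (f a + if a ∈ F then 0 else 1 - f a) = ∏ a ∈ F, f a := by
    rw [← Finset.prod_subset (Finset.subset_univ F)]
    · exact Finset.prod_congr rfl fun a ha => by simp [ha]
    · intro a _ ha
      simp [ha]
  rw [← h1, h, Finset.sum_filter]
  refine Finset.sum_congr rfl fun L _ => ?_
  split_ifs with hL
  · congr 1
    refine Finset.prod_congr rfl fun a ha => ?_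
    have : a ∉ F := fun h' => (Finset.mem_sdiff.1 ha).2 (hL h')
    simp [this]
  · obtain ⟨a, haF, haL⟩ := Finset.not_subset.1 hL
    symm
    refine mul_eq_zero_of_right _ (Finset.prod_eq_zero (i := a) ?_ ?_)
    · simp [haL]
    · simp [haF]

theorem success_probability_lt_sum_of_proofs {α : Type*} [Fintype α] [DecidableEq α]
    (f : α → ℝ) (hf : ∀ a, 0 < f a ∧ f a < 1) (F₁ F₂ : Finset α)
    (hne : (F₁ ∪ F₂).Nonempty) :
    ∑ L ∈ (Finset.univ : Finset α).powerset.filter (fun L => F₁ ⊆ L ∨ F₂ ⊆ L),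
      ((∏ a ∈ L, f a) * ∏ a ∈ Finset.univ \ L, (1 - f a))
      < (∏ a ∈ F₁, f a) + ∏ a ∈ F₂, f a := by
  rw [← sum_worlds_eq f F₁, ← sum_worlds_eq f F₂, Finset.filter_or, ← Finset.sum_union_inter]
  refine lt_add_of_pos_right _ (Finset.sum_pos ?_ ⟨Finset.univ, by simp⟩)
  intro L _
  exact mul_pos (Finset.prod_pos fun a _ => (hf a).1)
    (Finset.prod_pos fun a _ => sub_pos.2 (hf a).2)
end

section
/- Let A be a type of ground atoms and P a ground definite logic program over A, i.e., a set of clauses (h, B) with head h : A and body a finite set B of atoms. Let (h₀, insert a B₀) ∈ P be a clause whose body contains the atom a, and let P' = (P \ {(h₀, insert a B₀)}) ∪ { (h₀, B₀ ∪ B) | (a, B) ∈ P } be the program obtained by unfolding a in that clause using all clauses of P with head a. Then the least Herbrand models of P and P' coincide: lfp T_P = lfp T_{P'}, where T_Q is the (monotone) immediate-consequence operator of a program Q. In particular, an atom q is provable in P iff it is provable in P'. -/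
/-- The immediate-consequence operator of a ground definite logic program,
    given as a set of clauses `(head, body)`. -/
def immediateConsequence {A : Type*} (P : Set (A × Finset A)) : Set A →o Set A where
  toFun I := {h | ∃ B : Finset A, (h, B) ∈ P ∧ ↑B ⊆ I}
  monotone' := fun I J hIJ h hh => by
    obtain ⟨B, hBP, hBI⟩ := hh
    exact ⟨B, hBP, hBI.trans hIJ⟩

theorem unfolding_preserves_least_herbrand_model {A : Type*} [DecidableEq A]
    (P : Set (A × Finset A)) (h₀ a : A) (B₀ : Finset A)
    (hclause : (h₀, insert a B₀) ∈ P) :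
    OrderHom.lfp (immediateConsequence
        ((P \ {(h₀, insert a B₀)}) ∪
          {c | ∃ B : Finset A, (a, B) ∈ P ∧ c = (h₀, B₀ ∪ B)}))
      = OrderHom.lfp (immediateConsequence P) ∧
    ∀ q : A, q ∈ OrderHom.lfp (immediateConsequence P) ↔
      q ∈ OrderHom.lfp (immediateConsequence
        ((P \ {(h₀, insert a B₀)}) ∪
          {c | ∃ B : Finset A, (a, B) ∈ P ∧ c = (h₀, B₀ ∪ B)})) := by
  have closed : ∀ (Q : Set (A × Finset A)) (h : A) (B : Finset A), (h, B) ∈ Q →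
      (∀ x ∈ B, x ∈ OrderHom.lfp (immediateConsequence Q)) →
      h ∈ OrderHom.lfp (immediateConsequence Q) := by
    intro Q h B hB hsub
    rw [← OrderHom.map_lfp]
    exact ⟨B, hB, fun x hx => hsub x (by simpa using hx)⟩
  have key : OrderHom.lfp (immediateConsequence
        ((P \ {(h₀, insert a B₀)}) ∪
          {c | ∃ B : Finset A, (a, B) ∈ P ∧ c = (h₀, B₀ ∪ B)}))
      = OrderHom.lfp (immediateConsequence P) := by
    apply le_antisymm
    · apply OrderHom.lfp_le
      rintro h ⟨B, hB | ⟨C, hC, hEq⟩, hsub⟩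
      · exact closed P h B hB.1 (fun x hx => hsub (by simpa using hx))
      · obtain ⟨rfl, rfl⟩ := Prod.mk.inj hEq
        have ha := closed P a C hC (fun x hx => hsub (by simp [hx]))
        refine closed P _ _ hclause (fun x hx => ?_)
        rcases Finset.mem_insert.1 hx with rfl | hx
        · exact ha
        · exact hsub (by simp [hx])
    · apply OrderHom.lfp_le
      rintro h ⟨B, hB, hsub⟩
      by_cases hc : (h, B) = (h₀, insert a B₀)
      · obtain ⟨rfl, rfl⟩ := Prod.mk.inj hc
        have ha := hsub (show a ∈ _ by simp)
        have ha' := ha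
        rw [← OrderHom.map_lfp] at ha'
        obtain ⟨C, hC | ⟨D, hD, hEq⟩, hCsub⟩ := ha'
        · refine closed _ h (B₀ ∪ C) (Or.inr ⟨C, hC.1, rfl⟩) (fun x hx => ?_)
          rcases Finset.mem_union.1 hx with hx | hx
          · exact hsub (by simp [hx])
          · exact hCsub (by simpa using hx)
        · rw [(Prod.mk.inj hEq).1] at ha
          simpa only [(Prod.mk.inj hEq).1] using ha
      · exact closed _ h B (Or.inl ⟨hB, hc⟩) (fun x hx => hsub (by simpa using hx))
  exact ⟨key, fun q => by rw [key]⟩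
end

section
/- Let A be a type of ground atoms, P a ground definite logic program over A, and q : A a query. Let R ⊆ A be the set of atoms reachable from q in the dependency relation of P (the reflexive–transitive closure of the relation relating h to each b ∈ B for every clause (h, B) ∈ P), and let P' = { (h, B) ∈ P | h ∈ R } be the subprogram of clauses whose head is relevant to q. Then q ∈ lfp T_P ↔ q ∈ lfp T_{P'}. Hence clauses and facts outside the dependency closure of a query are irrelevant to its provability, and a minimal explanation of q need not mention them. -/
/-- The dependency relation of a ground definite logic program: `dep P h b` holds
    when some clause of `P` with head `h` has `b` in its body. -/
def dep {A : Type*} (P : Set (A × Finset A)) (h b : A) : Prop :=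
  ∃ B : Finset A, (h, B) ∈ P ∧ b ∈ B

theorem irrelevant_clauses_can_be_removed {A : Type*}
    (P : Set (A × Finset A)) (q : A) :
    q ∈ OrderHom.lfp (immediateConsequence P) ↔
      q ∈ OrderHom.lfp (immediateConsequence
            {c ∈ P | Relation.ReflTransGen (dep P) q c.1}) := by
  set P' : Set (A × Finset A) := {c ∈ P | Relation.ReflTransGen (dep P) q c.1} with hP'
  constructor
  · intro hq
    have hle : OrderHom.lfp (immediateConsequence P) ≤
        {a | Relation.ReflTransGen (dep P) q a →
          a ∈ OrderHom.lfp (immediateConsequence P')} := by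
      apply OrderHom.lfp_le
      rintro h ⟨B, hB, hsub⟩ hr
      rw [← OrderHom.map_lfp]
      exact ⟨B, ⟨hB, hr⟩, fun b hb => hsub hb (hr.tail ⟨B, hB, hb⟩)⟩
    exact hle hq Relation.ReflTransGen.refl
  · intro hq
    have hle : OrderHom.lfp (immediateConsequence P') ≤
        OrderHom.lfp (immediateConsequence P) := by
      apply OrderHom.lfp_le
      rintro h ⟨B, hB, hsub⟩
      rw [← OrderHom.map_lfp]
      exact ⟨B, hB.1, hsub⟩
    exact hle hq
end
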